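/- arXiv:2307.07884 — 2 statements merged into one kernel-verified Lean document; each statement's English description precedes it below -/
import Mathlib

section
/- Let M, M̃ ∈ ℝ^{n×n} be symmetric positive definite matrices, and let U ∈ ℝ^{n×n} be an invertible matrix and λ_1,…,λ_n > 0 be such that UᵀM̃U = I_n and UᵀMU = diag(λ_1,…,λ_n). Then (1/κ(M̃)) · ‖M−M̃‖_F/‖M̃‖_F ≤ sqrt( (1/n) Σ_{i=1}^n (1 − λ_i)² ) ≤ κ(M̃) · ‖M−M̃‖_F/‖M̃‖_F, where κ(M̃) = λ_max(M̃)/λ_min(M̃) is the spectral condition number of M̃. -/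
open Matrix

/-- Frobenius norm: `‖A‖_F = trace(Aᵀ A)^{1/2}`. -/
noncomputable def frobNorm {m n : Type*} [Fintype m] [Fintype n]
    (A : Matrix m n ℝ) : ℝ := Real.sqrt (Matrix.trace (Aᵀ * A))

/-- Spectral condition number of a symmetric positive definite matrix:
`κ(M) = λ_max(M) / λ_min(M)`. -/
noncomputable def specCond {n : ℕ} {M : Matrix (Fin n) (Fin n) ℝ}
    (hM : M.PosDef) : ℝ :=
  (⨆ i, hM.isHermitian.eigenvalues i) / (⨅ i, hM.isHermitian.eigenvalues i)

theorem exists_orthogonal_diagonalization {n : Type*} [Fintype n] [DecidableEq n]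
    {A : Matrix n n ℝ} (hA : A.IsHermitian) :
    ∃ V : Matrix n n ℝ, Vᵀ * V = 1 ∧ V * Vᵀ = 1 ∧
      A = V * diagonal hA.eigenvalues * Vᵀ := by
  refine ⟨hA.eigenvectorUnitary, ?_, ?_, ?_⟩
  · exact Unitary.coe_star_mul_self hA.eigenvectorUnitary
  · exact Unitary.coe_mul_star_self hA.eigenvectorUnitary
  · exact hA.spectral_theorem

theorem trace_transpose_mul_self_eq_sum {m n : Type*} [Fintype m] [Fintype n]
    (A : Matrix m n ℝ) : trace (Aᵀ * A) = ∑ i, ∑ j, A j i ^ 2 := by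
  simp [trace, mul_apply, sq]

theorem trace_transpose_mul_self_conj {n : Type*} [Fintype n] [DecidableEq n]
    (A V : Matrix n n ℝ) (hV : V * Vᵀ = 1) :
    trace ((Vᵀ * A * V)ᵀ * (Vᵀ * A * V)) = trace (Aᵀ * A) := by
  calc trace ((Vᵀ * A * V)ᵀ * (Vᵀ * A * V))
      = trace (Vᵀ * (Aᵀ * (V * Vᵀ) * A * V)) := by
        simp only [transpose_mul, transpose_transpose, Matrix.mul_assoc]
    _ = trace (Aᵀ * A) := by
        rw [trace_mul_comm, hV]
        simp only [Matrix.mul_assoc, hV, Matrix.mul_one]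

theorem trace_transpose_mul_self_congruence {n : Type*} [Fintype n] [DecidableEq n]
    (E U V : Matrix n n ℝ) (d : n → ℝ) (hE : Eᵀ = E)
    (hP : U * Uᵀ = V * diagonal d * Vᵀ) :
    trace ((Uᵀ * E * U)ᵀ * (Uᵀ * E * U)) =
      ∑ i, ∑ j, (Vᵀ * E * V) j i ^ 2 * (d i * d j) := by
  have hF : (Vᵀ * E * V)ᵀ = Vᵀ * E * V := by
    simp only [transpose_mul, transpose_transpose, hE, Matrix.mul_assoc]
  calc trace ((Uᵀ * E * U)ᵀ * (Uᵀ * E * U))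
      = trace (Uᵀ * (E * (U * Uᵀ) * E * U)) := by
        simp only [transpose_mul, transpose_transpose, hE, Matrix.mul_assoc]
    _ = trace (E * (U * Uᵀ) * E * (U * Uᵀ)) := by
        rw [trace_mul_comm]; simp only [Matrix.mul_assoc]
    _ = trace ((E * V * diagonal d * Vᵀ * E * V * diagonal d) * Vᵀ) := by
        rw [hP]; simp only [Matrix.mul_assoc]
    _ = trace (((Vᵀ * E * V) * diagonal d) * ((Vᵀ * E * V) * diagonal d)) := by
        rw [trace_mul_comm]; simp only [Matrix.mul_assoc]
    _ = ∑ i, ∑ j, (Vᵀ * E * V) j i ^ 2 * (d i * d j) := by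
        generalize Vᵀ * E * V = F at hF ⊢
        rw [trace]
        refine Finset.sum_congr rfl fun i _ => ?_
        rw [diag_apply, mul_apply]
        refine Finset.sum_congr rfl fun j _ => ?_
        have hs : F i j = F j i := congrFun (congrFun hF j) i
        rw [mul_diagonal, mul_diagonal, hs]
        ring

theorem stmt1 {n : ℕ} (M Mt U : Matrix (Fin n) (Fin n) ℝ)
    (hM : M.PosDef) (hMt : Mt.PosDef) (hU : IsUnit U.det)
    (lam : Fin n → ℝ) (hlam : ∀ i, 0 < lam i)
    (h1 : Uᵀ * Mt * U = 1) (h2 : Uᵀ * M * U = Matrix.diagonal lam) :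
    (1 / specCond hMt) * (frobNorm (M - Mt) / frobNorm Mt) ≤
        Real.sqrt ((1 / (n : ℝ)) * ∑ i, (1 - lam i) ^ 2) ∧
      Real.sqrt ((1 / (n : ℝ)) * ∑ i, (1 - lam i) ^ 2) ≤
        specCond hMt * (frobNorm (M - Mt) / frobNorm Mt) := by
  rcases Nat.eq_zero_or_pos n with rfl | hn
  · simp [frobNorm]
  have : Nonempty (Fin n) := ⟨⟨0, hn⟩⟩
  have hn' : (0 : ℝ) < n := by exact_mod_cast hn
  obtain ⟨V, hVV, hVV', hspec⟩ := exists_orthogonal_diagonalization hMt.isHermitian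
  have hdpos : ∀ i, 0 < hMt.isHermitian.eigenvalues i := hMt.eigenvalues_pos
  unfold specCond frobNorm
  set d := hMt.isHermitian.eigenvalues
  set L := ⨆ i, d i
  set m := ⨅ i, d i with hm
  have hdL : ∀ i, d i ≤ L := fun i => le_ciSup (Set.finite_range d).bddAbove i
  have hmd : ∀ i, m ≤ d i := fun i => ciInf_le (Set.finite_range d).bddBelow i
  have hm0 : 0 < m := by
    obtain ⟨i, hi⟩ := exists_eq_ciInf_of_finite (f := d)
    rw [hm, ← hi]; exact hdpos i
  have hL0 : 0 < L := hm0.trans_le ((hmd ⟨0, hn⟩).trans (hdL _))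
  have hE : (M - Mt)ᵀ = M - Mt := hM.isHermitian.sub hMt.isHermitian
  have hP : U * Uᵀ = V * diagonal (fun i => (d i)⁻¹) * Vᵀ := by
    have hleft : (U * Uᵀ) * Mt = 1 := by
      rw [Matrix.mul_assoc]; exact mul_eq_one_comm.mp h1
    have hright : Mt * (V * diagonal (fun i => (d i)⁻¹) * Vᵀ) = 1 := by
      calc Mt * (V * diagonal (fun i => (d i)⁻¹) * Vᵀ)
          = V * (diagonal d * (Vᵀ * V) * diagonal (fun i => (d i)⁻¹)) * Vᵀ := by
            conv_lhs => rw [hspec]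
            simp only [Matrix.mul_assoc]
        _ = 1 := by
            rw [hVV, Matrix.mul_one, diagonal_mul_diagonal]
            simp [fun i => mul_inv_cancel₀ (hdpos i).ne', hVV']
    exact left_inv_eq_right_inv hleft hright
  have hS : ∑ i, (1 - lam i) ^ 2 =
      trace ((Uᵀ * (M - Mt) * U)ᵀ * (Uᵀ * (M - Mt) * U)) := by
    rw [Matrix.mul_sub, Matrix.sub_mul, h1, h2, ← diagonal_one, diagonal_sub,
      diagonal_transpose, diagonal_mul_diagonal, trace_diagonal]
    exact Finset.sum_congr rfl fun i _ => by ring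
  rw [trace_transpose_mul_self_congruence _ U V _ hE hP] at hS
  have hEF := trace_transpose_mul_self_conj (M - Mt) V hVV'
  rw [trace_transpose_mul_self_eq_sum] at hEF
  have hT : trace (Mtᵀ * Mt) = ∑ i, d i ^ 2 := by
    rw [← trace_transpose_mul_self_conj Mt V hVV']
    have : Vᵀ * Mt * V = diagonal d := by
      calc Vᵀ * Mt * V = (Vᵀ * V) * diagonal d * (Vᵀ * V) := by
            conv_lhs => rw [hspec]
            simp only [Matrix.mul_assoc]
        _ = diagonal d := by rw [hVV]; simp
    rw [this, diagonal_transpose, diagonal_mul_diagonal, trace_diagonal]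
    exact Finset.sum_congr rfl fun i _ => by ring
  set e := trace ((M - Mt)ᵀ * (M - Mt))
  set t := trace (Mtᵀ * Mt)
  set S := ∑ i, (1 - lam i) ^ 2
  have he0 : 0 ≤ e := by rw [← hEF]; positivity
  have hSup : S ≤ e * (m⁻¹ * m⁻¹) := by
    rw [hS, ← hEF, Finset.sum_mul]
    refine Finset.sum_le_sum fun i _ => ?_
    rw [Finset.sum_mul]
    refine Finset.sum_le_sum fun j _ => ?_
    have := hmd i
    have := hmd j
    have := hdpos i
    have := hdpos j
    gcongr
  have hSlo : e * (L⁻¹ * L⁻¹) ≤ S := by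
    rw [hS, ← hEF, Finset.sum_mul]
    refine Finset.sum_le_sum fun i _ => ?_
    rw [Finset.sum_mul]
    refine Finset.sum_le_sum fun j _ => ?_
    have := hdL i
    have := hdL j
    have := hdpos i
    have := hdpos j
    gcongr
  have htup : t ≤ n * L ^ 2 := by
    rw [hT]
    calc ∑ i, d i ^ 2 ≤ ∑ _i : Fin n, L ^ 2 :=
          Finset.sum_le_sum fun i _ => pow_le_pow_left₀ (hdpos i).le (hdL i) 2
      _ = n * L ^ 2 := by simp
  have htlo : n * m ^ 2 ≤ t := by
    rw [hT]
    calc n * m ^ 2 = ∑ _i : Fin n, m ^ 2 := by simp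
      _ ≤ ∑ i, d i ^ 2 :=
          Finset.sum_le_sum fun i _ => pow_le_pow_left₀ hm0.le (hmd i) 2
  have ht0 : 0 < t := lt_of_lt_of_le (by positivity) htlo
  constructor
  · refine Real.le_sqrt_of_sq_le ?_
    rw [mul_pow, div_pow √e, Real.sq_sqrt he0, Real.sq_sqrt ht0.le]
    calc (1 / (L / m)) ^ 2 * (e / t) ≤ (1 / (L / m)) ^ 2 * (e / (n * m ^ 2)) := by gcongr
      _ = 1 / n * (e * (L⁻¹ * L⁻¹)) := by field_simp
      _ ≤ 1 / n * S := by gcongr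
  · refine Real.sqrt_le_iff.mpr ⟨by positivity, ?_⟩
    rw [mul_pow, div_pow √e, Real.sq_sqrt he0, Real.sq_sqrt ht0.le]
    calc 1 / n * S ≤ 1 / n * (e * (m⁻¹ * m⁻¹)) := by gcongr
      _ = (L / m) ^ 2 * (e / (n * L ^ 2)) := by field_simp
      _ ≤ (L / m) ^ 2 * (e / t) := by gcongr
end

section
/- Let A_1,…,A_r, Y_1,…,Y_q ∈ ℝ^{n×n} and B_1,…,B_r, Z_1,…,Z_q ∈ ℝ^{m×m}. For each s, let Y_s' be the orthogonal projection (with respect to the Frobenius inner product) of Y_s onto the linear span of {A_1,…,A_r}. Then ‖Σ_{k=1}^r A_k ⊗ B_k − Σ_{s=1}^q Y_s' ⊗ Z_s‖_F ≤ ‖Σ_{k=1}^r A_k ⊗ B_k − Σ_{s=1}^q Y_s ⊗ Z_s‖_F. In particular, any best Kronecker rank-q approximation of Σ_{k=1}^r A_k ⊗ B_k can be chosen with all left factor matrices in span{A_1,…,A_r}. -/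
open Matrix
open scoped Kronecker

/-- Frobenius inner product: `⟨A,B⟩_F = trace(Aᵀ B)`. -/
noncomputable def frobInner {m n : Type*} [Fintype m] [Fintype n]
    (A B : Matrix m n ℝ) : ℝ := Matrix.trace (Aᵀ * B)

theorem frobInner_self_nonneg {m n : Type*} [Fintype m] [Fintype n] (A : Matrix m n ℝ) :
    0 ≤ frobInner A A := by
  simp only [frobInner, Matrix.trace, Matrix.diag, Matrix.mul_apply, Matrix.transpose_apply]
  exact Finset.sum_nonneg fun _ _ => Finset.sum_nonneg fun _ _ => mul_self_nonneg _

theorem frobInner_comm {m n : Type*} [Fintype m] [Fintype n] (A B : Matrix m n ℝ) :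
    frobInner A B = frobInner B A := by
  rw [frobInner, frobInner, ← Matrix.trace_transpose, Matrix.transpose_mul,
    Matrix.transpose_transpose]

theorem frobInner_sub_left {m n : Type*} [Fintype m] [Fintype n] (A B C : Matrix m n ℝ) :
    frobInner (A - B) C = frobInner A C - frobInner B C := by
  simp [frobInner, Matrix.sub_mul]

theorem frobInner_sub_right {m n : Type*} [Fintype m] [Fintype n] (A B C : Matrix m n ℝ) :
    frobInner A (B - C) = frobInner A B - frobInner A C := by
  simp [frobInner, Matrix.mul_sub]

theorem frobInner_sum_left {ι m n : Type*} [Fintype m] [Fintype n] (s : Finset ι)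
    (A : ι → Matrix m n ℝ) (B : Matrix m n ℝ) :
    frobInner (∑ i ∈ s, A i) B = ∑ i ∈ s, frobInner (A i) B := by
  simp [frobInner, Matrix.transpose_sum, Matrix.sum_mul, Matrix.trace_sum]

theorem frobInner_sum_right {ι m n : Type*} [Fintype m] [Fintype n] (s : Finset ι)
    (A : Matrix m n ℝ) (B : ι → Matrix m n ℝ) :
    frobInner A (∑ i ∈ s, B i) = ∑ i ∈ s, frobInner A (B i) := by
  simp [frobInner, Matrix.mul_sum, Matrix.trace_sum]

theorem frobInner_kronecker {m n p q : Type*} [Fintype m] [Fintype n] [Fintype p] [Fintype q]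
    (A C : Matrix m n ℝ) (B D : Matrix p q ℝ) :
    frobInner (A ⊗ₖ B) (C ⊗ₖ D) = frobInner A C * frobInner B D := by
  rw [frobInner, ← Matrix.kroneckerMap_transpose, ← Matrix.mul_kronecker_mul,
    Matrix.trace_kronecker, frobInner, frobInner]

/-- Subtracting a Frobenius-orthogonal matrix does not decrease the Frobenius norm. -/
theorem frobNorm_le_frobNorm_sub {m n : Type*} [Fintype m] [Fintype n] {P D : Matrix m n ℝ}
    (h : frobInner P D = 0) : frobNorm P ≤ frobNorm (P - D) := by
  refine Real.sqrt_le_sqrt ?_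
  change frobInner P P ≤ frobInner (P - D) (P - D)
  rw [frobInner_sub_left, frobInner_sub_right, frobInner_sub_right, frobInner_comm D P, h]
  linarith [frobInner_self_nonneg D]

/-- `Y' s` is the orthogonal projection (w.r.t. the Frobenius inner
product) of `Y s` onto `span{A_1, …, A_r}`, characterized by membership in the span
together with orthogonality of the residual `Y s - Y' s` to the span. -/
theorem stmt12 {n m r q : ℕ}
    (A : Fin r → Matrix (Fin n) (Fin n) ℝ) (B : Fin r → Matrix (Fin m) (Fin m) ℝ)
    (Y Y' : Fin q → Matrix (Fin n) (Fin n) ℝ) (Z : Fin q → Matrix (Fin m) (Fin m) ℝ)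
    (hmem : ∀ s, Y' s ∈ Submodule.span ℝ (Set.range A))
    (horth : ∀ s, ∀ W ∈ Submodule.span ℝ (Set.range A), frobInner W (Y s - Y' s) = 0) :
    frobNorm ((∑ k, A k ⊗ₖ B k) - ∑ s, Y' s ⊗ₖ Z s) ≤
      frobNorm ((∑ k, A k ⊗ₖ B k) - ∑ s, Y s ⊗ₖ Z s) := by
  have hsplit : (∑ k, A k ⊗ₖ B k) - ∑ s, Y s ⊗ₖ Z s =
      ((∑ k, A k ⊗ₖ B k) - ∑ s, Y' s ⊗ₖ Z s) - ∑ s, (Y s - Y' s) ⊗ₖ Z s := by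
    have hsub (s : Fin q) : (Y s - Y' s) ⊗ₖ Z s = Y s ⊗ₖ Z s - Y' s ⊗ₖ Z s := by
      ext
      simp [sub_mul]
    simp only [hsub, Finset.sum_sub_distrib]
    abel
  rw [hsplit]
  apply frobNorm_le_frobNorm_sub
  have hA (k : Fin r) (s : Fin q) : frobInner (A k) (Y s - Y' s) = 0 :=
    horth s _ (Submodule.subset_span ⟨k, rfl⟩)
  have hY (t s : Fin q) : frobInner (Y' t) (Y s - Y' s) = 0 := horth s _ (hmem t)
  simp [frobInner_sub_left, frobInner_sum_left, frobInner_sum_right, frobInner_kronecker, hA, hY]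
end
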